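/- arXiv:2404.00850 — 3 statements merged into one kernel-verified Lean document; each statement's English description precedes it below -/
import Mathlib

section
/- Let A, B be real n×n matrices, let H and C₀ be symmetric positive definite real n×n matrices satisfying AᵀHA − H = −C₀, and define α, β from H, C₀, A, B as in the context. Let τ̄ ≥ 1 be an integer, let τ : ℕ → ℕ be any delay sequence with 1 ≤ τ_t ≤ τ̄ for all t, and let x : ℕ → ℝⁿ satisfy x_{t+1} = A x_t + B x_{t−τ_t} for all t ≥ τ̄. If α + β < 1, then x converges to zero exponentially fast: there exist a constant K ≥ 0 and a rate r ∈ (0,1) such that ‖x_t‖ ≤ K·rᵗ for all t. -/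
open Matrix

/-- The ℓ²→ℓ² operator norm of a real square matrix. -/
noncomputable def opNorm {n : ℕ} (M : Matrix (Fin n) (Fin n) ℝ) : ℝ :=
  ‖Matrix.toEuclideanCLM (𝕜 := ℝ) M‖

/-- The quadratic form of a real Hermitian matrix is bounded below by any lower bound of its
eigenvalues. -/
lemma Matrix.IsHermitian.mul_dotProduct_self_le {n : ℕ} {M : Matrix (Fin n) (Fin n) ℝ}
    (hM : M.IsHermitian) {a : ℝ} (ha : ∀ i, a ≤ hM.eigenvalues i) (v : Fin n → ℝ) :
    a * (v ⬝ᵥ v) ≤ v ⬝ᵥ M *ᵥ v := by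
  have hP : (M - algebraMap ℝ _ a).PosSemidef := by
    rw [posSemidef_iff_isHermitian_and_spectrum_nonneg]
    refine ⟨hM.sub ?_, ?_⟩
    · rw [Algebra.algebraMap_eq_smul_one]
      simp [Matrix.IsHermitian]
    · rw [← spectrum.sub_singleton_eq, hM.spectrum_real_eq_range_eigenvalues]
      rintro _ ⟨_, ⟨i, rfl⟩, _, rfl, rfl⟩
      simpa using ha i
  have h := hP.dotProduct_mulVec_nonneg v
  simp only [star_trivial, Algebra.algebraMap_eq_smul_one, sub_mulVec, smul_mulVec, one_mulVec,
    dotProduct_sub, dotProduct_smul, smul_eq_mul] at h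
  linarith

/-- The quadratic form of a real Hermitian matrix is bounded above by any upper bound of its
eigenvalues. -/
lemma Matrix.IsHermitian.le_mul_dotProduct_self {n : ℕ} {M : Matrix (Fin n) (Fin n) ℝ}
    (hM : M.IsHermitian) {b : ℝ} (hb : ∀ i, hM.eigenvalues i ≤ b) (v : Fin n → ℝ) :
    v ⬝ᵥ M *ᵥ v ≤ b * (v ⬝ᵥ v) := by
  have hP : (algebraMap ℝ _ b - M).PosSemidef := by
    rw [posSemidef_iff_isHermitian_and_spectrum_nonneg]
    refine ⟨Matrix.IsHermitian.sub ?_ hM, ?_⟩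
    · rw [Algebra.algebraMap_eq_smul_one]
      simp [Matrix.IsHermitian]
    · rw [← spectrum.singleton_sub_eq, hM.spectrum_real_eq_range_eigenvalues]
      rintro _ ⟨_, rfl, _, ⟨i, rfl⟩, rfl⟩
      simpa using hb i
  have h := hP.dotProduct_mulVec_nonneg v
  simp only [star_trivial, Algebra.algebraMap_eq_smul_one, sub_mulVec, smul_mulVec, one_mulVec,
    dotProduct_sub, dotProduct_smul, smul_eq_mul] at h
  linarith

lemma opNorm_nonneg {n : ℕ} (M : Matrix (Fin n) (Fin n) ℝ) : 0 ≤ opNorm M :=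
  norm_nonneg _

lemma norm_toLp_sq {n : ℕ} (v : Fin n → ℝ) : ‖WithLp.toLp 2 v‖ ^ 2 = v ⬝ᵥ v := by
  rw [EuclideanSpace.real_norm_sq_eq]
  simp [dotProduct, sq]

lemma dotProduct_mulVec_le_opNorm {n : ℕ} (M : Matrix (Fin n) (Fin n) ℝ) (u v : Fin n → ℝ) :
    u ⬝ᵥ M *ᵥ v ≤ opNorm M * (‖WithLp.toLp 2 u‖ * ‖WithLp.toLp 2 v‖) := by
  have h1 := real_inner_le_norm (WithLp.toLp 2 u)
    (Matrix.toEuclideanCLM (𝕜 := ℝ) M (WithLp.toLp 2 v))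
  have h2 := (Matrix.toEuclideanCLM (𝕜 := ℝ) M).le_opNorm (WithLp.toLp 2 v)
  have h3 : inner ℝ (WithLp.toLp 2 u) (Matrix.toEuclideanCLM (𝕜 := ℝ) M (WithLp.toLp 2 v))
      = u ⬝ᵥ M *ᵥ v := by
    rw [Matrix.toEuclideanCLM_toLp, EuclideanSpace.inner_toLp_toLp, star_trivial, dotProduct_comm]
  rw [h3] at h1
  calc u ⬝ᵥ M *ᵥ v ≤ _ := h1
    _ ≤ ‖WithLp.toLp 2 u‖ * (opNorm M * ‖WithLp.toLp 2 v‖) := by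
      gcongr
      exact h2
    _ = _ := by ring

lemma dotProduct_mulVec_self_le_opNorm {n : ℕ} (M : Matrix (Fin n) (Fin n) ℝ) (v : Fin n → ℝ) :
    v ⬝ᵥ M *ᵥ v ≤ opNorm M * (v ⬝ᵥ v) := by
  have h := dotProduct_mulVec_le_opNorm M v v
  rwa [← sq, norm_toLp_sq] at h

lemma two_mul_dotProduct_mulVec_le_opNorm {n : ℕ} (M : Matrix (Fin n) (Fin n) ℝ)
    (u v : Fin n → ℝ) : 2 * (u ⬝ᵥ M *ᵥ v) ≤ opNorm M * (u ⬝ᵥ u + v ⬝ᵥ v) := by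
  have h := dotProduct_mulVec_le_opNorm M u v
  have h' := mul_le_mul_of_nonneg_left
    (two_mul_le_add_sq ‖WithLp.toLp 2 u‖ ‖WithLp.toLp 2 v‖) (opNorm_nonneg M)
  rw [norm_toLp_sq, norm_toLp_sq] at h'
  linarith

lemma norm_sq_le_dotProduct_self {n : ℕ} (v : Fin n → ℝ) : ‖v‖ ^ 2 ≤ v ⬝ᵥ v := by
  rw [← norm_toLp_sq]
  gcongr
  rw [pi_norm_le_iff_of_nonneg (norm_nonneg _)]
  exact fun i => PiLp.norm_apply_le (WithLp.toLp 2 v) i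

/-- Expansion of the quadratic form of `H` along one step of the delayed system. -/
lemma dotProduct_mulVec_step {n : ℕ} {A B H C : Matrix (Fin n) (Fin n) ℝ} (hH : Hᵀ = H)
    (hLyap : Aᵀ * H * A - H = -C) (u v : Fin n → ℝ) :
    (A *ᵥ u + B *ᵥ v) ⬝ᵥ H *ᵥ (A *ᵥ u + B *ᵥ v)
      = u ⬝ᵥ H *ᵥ u - u ⬝ᵥ C *ᵥ u + 2 * (u ⬝ᵥ (Aᵀ * H * B) *ᵥ v)
        + v ⬝ᵥ (Bᵀ * H * B) *ᵥ v := by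
  have key (M N : Matrix (Fin n) (Fin n) ℝ) (p q : Fin n → ℝ) :
      (M *ᵥ p) ⬝ᵥ H *ᵥ (N *ᵥ q) = p ⬝ᵥ (Mᵀ * H * N) *ᵥ q := by
    rw [← mulVec_mulVec, ← mulVec_mulVec, dotProduct_mulVec p, vecMul_transpose]
  have hsymm : v ⬝ᵥ (Bᵀ * H * A) *ᵥ u = u ⬝ᵥ (Aᵀ * H * B) *ᵥ v := by
    rw [dotProduct_mulVec, dotProduct_comm, ← mulVec_transpose]
    simp [hH, Matrix.mul_assoc]
  have hA : Aᵀ * H * A = H - C := by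
    rw [sub_eq_iff_eq_add] at hLyap
    rw [hLyap]; abel
  rw [mulVec_add, dotProduct_add, add_dotProduct, add_dotProduct, key, key, key, key, hsymm, hA,
    sub_mulVec, dotProduct_sub]
  ring

/-- A discrete Halanay inequality: delayed contraction implies geometric decay. -/
lemma exists_geometric_bound_of_delay {V : ℕ → ℝ} (hV : ∀ t, 0 ≤ V t) {α β : ℝ}
    (hα : 0 ≤ α) (hβ : 0 ≤ β) (hαβ : α + β < 1) {d : ℕ} {τ : ℕ → ℕ}
    (hτ : ∀ t, τ t ≤ d) (h : ∀ t, d ≤ t → V (t + 1) ≤ α * V t + β * V (t - τ t)) :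
    ∃ K ≥ (0 : ℝ), ∃ s ∈ Set.Ioo (0 : ℝ) 1, ∀ t, V t ≤ K * s ^ t := by
  obtain ⟨s, ⟨hs0, hs1⟩, hs⟩ :
      ∃ s ∈ Set.Ioo (0 : ℝ) 1, α + β ≤ s ^ (d + 1) := by
    have hd : (0 : ℝ) < d + 2 := by positivity
    have hδ : 0 < (1 - (α + β)) / (d + 2) := div_pos (by linarith) hd
    have hδ1 : (1 - (α + β)) / (d + 2) < 1 := by
      rw [div_lt_one hd]
      have : (0 : ℝ) ≤ d := by positivity
      linarith
    have hmul : (1 - (α + β)) / (d + 2) * (d + 2) = 1 - (α + β) := div_mul_cancel₀ _ hd.ne'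
    refine ⟨1 - (1 - (α + β)) / (d + 2), ⟨by linarith, by linarith⟩, ?_⟩
    have hB := one_add_mul_le_pow (a := -((1 - (α + β)) / (d + 2))) (by linarith) (d + 1)
    rw [← sub_eq_add_neg] at hB
    push_cast at hB
    nlinarith
  refine ⟨∑ i ∈ Finset.range (d + 1), V i / s ^ i, ?_, s, ⟨hs0, hs1⟩, ?_⟩
  · exact Finset.sum_nonneg fun i _ => div_nonneg (hV i) (by positivity)
  have hK0 : 0 ≤ ∑ i ∈ Finset.range (d + 1), V i / s ^ i :=
    Finset.sum_nonneg fun i _ => div_nonneg (hV i) (by positivity)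
  intro t
  induction t using Nat.strong_induction_on with
  | _ t ih =>
    rcases Nat.lt_or_ge d t with ht | ht
    · obtain ⟨t, rfl⟩ : ∃ m, t = m + 1 := ⟨t - 1, by omega⟩
      have hdt : d ≤ t := by omega
      set K := ∑ i ∈ Finset.range (d + 1), V i / s ^ i
      have hbound (m : ℕ) (hm : m ≤ t) (hm' : t - d ≤ m) : V m ≤ K * s ^ (t - d) :=
        (ih m (by omega)).trans (mul_le_mul_of_nonneg_left
          (pow_le_pow_of_le_one hs0.le hs1.le hm') hK0)
      calc V (t + 1) ≤ α * V t + β * V (t - τ t) := h t hdt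
        _ ≤ α * (K * s ^ (t - d)) + β * (K * s ^ (t - d)) := by
          have := hτ t
          gcongr
          · exact hbound t le_rfl (by omega)
          · exact hbound _ (by omega) (by omega)
        _ = (α + β) * (K * s ^ (t - d)) := by ring
        _ ≤ s ^ (d + 1) * (K * s ^ (t - d)) := by gcongr
        _ = K * s ^ (t + 1) := by
          rw [mul_left_comm, ← pow_add]
          congr 2
          omega
    · rw [← div_le_iff₀ (by positivity)]
      exact Finset.single_le_sum (f := fun i => V i / s ^ i)
        (fun i _ => div_nonneg (hV i) (by positivity)) (Finset.mem_range.2 (by omega))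

theorem stmt0 {n : ℕ} (A B H C₀ : Matrix (Fin n) (Fin n) ℝ)
    (hH : H.PosDef) (hC : C₀.PosDef)
    (hLyap : Aᵀ * H * A - H = -C₀)
    (c ηlo ηhi : ℝ)
    (hc : IsLeast (Set.range hC.1.eigenvalues) c)
    (hηlo : IsLeast (Set.range hH.1.eigenvalues) ηlo)
    (hηhi : IsGreatest (Set.range hH.1.eigenvalues) ηhi)
    (α β : ℝ)
    (hα : α = if opNorm (Aᵀ * H * B) < c
      then |ηhi - c + opNorm (Aᵀ * H * B)| / ηhi
      else |ηlo - c + opNorm (Aᵀ * H * B)| / ηlo)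
    (hβ : β = (opNorm (Aᵀ * H * B) + opNorm (Bᵀ * H * B)) / ηlo)
    (hαβ : α + β < 1)
    (τbar : ℕ) (hτbar : 1 ≤ τbar)
    (τ : ℕ → ℕ) (hτ : ∀ t, 1 ≤ τ t ∧ τ t ≤ τbar)
    (x : ℕ → Fin n → ℝ)
    (hx : ∀ t, τbar ≤ t → x (t + 1) = A.mulVec (x t) + B.mulVec (x (t - τ t))) :
    ∃ K ≥ (0 : ℝ), ∃ r ∈ Set.Ioo (0 : ℝ) 1, ∀ t, ‖x t‖ ≤ K * r ^ t := by
  have hlo (v : Fin n → ℝ) : ηlo * (v ⬝ᵥ v) ≤ v ⬝ᵥ H *ᵥ v :=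
    hH.1.mul_dotProduct_self_le (fun i => hηlo.2 ⟨i, rfl⟩) v
  have hhi (v : Fin n → ℝ) : v ⬝ᵥ H *ᵥ v ≤ ηhi * (v ⬝ᵥ v) :=
    hH.1.le_mul_dotProduct_self (fun i => hηhi.2 ⟨i, rfl⟩) v
  have hcC (v : Fin n → ℝ) : c * (v ⬝ᵥ v) ≤ v ⬝ᵥ C₀ *ᵥ v :=
    hC.1.mul_dotProduct_self_le (fun i => hc.2 ⟨i, rfl⟩) v
  have hlo0 : 0 < ηlo := by
    obtain ⟨i, rfl⟩ := hηlo.1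
    exact hH.eigenvalues_pos i
  have hhi0 : 0 < ηhi := hlo0.trans_le (hηhi.2 hηlo.1)
  have hP := opNorm_nonneg (Aᵀ * H * B)
  have hQ := opNorm_nonneg (Bᵀ * H * B)
  have hself (v : Fin n → ℝ) : 0 ≤ v ⬝ᵥ v := (sq_nonneg _).trans (norm_sq_le_dotProduct_self v)
  have hV (v : Fin n → ℝ) : 0 ≤ v ⬝ᵥ H *ᵥ v := (mul_nonneg hlo0.le (hself v)).trans (hlo v)
  have hα0 : 0 ≤ α := by
    rw [hα]
    split_ifs <;> positivity
  have hβ0 : 0 ≤ β := by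
    rw [hβ]
    positivity
  have hstepα (v : Fin n → ℝ) :
      v ⬝ᵥ H *ᵥ v - c * (v ⬝ᵥ v) + opNorm (Aᵀ * H * B) * (v ⬝ᵥ v) ≤ α * (v ⬝ᵥ H *ᵥ v) := by
    have hrate {η : ℝ} (hη : 0 < η)
        (h : (opNorm (Aᵀ * H * B) - c) * (η * (v ⬝ᵥ v))
          ≤ (opNorm (Aᵀ * H * B) - c) * (v ⬝ᵥ H *ᵥ v)) :
        v ⬝ᵥ H *ᵥ v - c * (v ⬝ᵥ v) + opNorm (Aᵀ * H * B) * (v ⬝ᵥ v)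
          ≤ |η - c + opNorm (Aᵀ * H * B)| / η * (v ⬝ᵥ H *ᵥ v) := by
      rw [div_mul_eq_mul_div, le_div_iff₀ hη]
      have := mul_le_mul_of_nonneg_right (le_abs_self (η - c + opNorm (Aᵀ * H * B))) (hV v)
      linarith
    rw [hα]
    split_ifs with hcP
    · exact hrate hhi0 (mul_le_mul_of_nonpos_left (hhi v) (by linarith))
    · exact hrate hlo0 (mul_le_mul_of_nonneg_left (hlo v) (by linarith))
  have hstepβ (v : Fin n → ℝ) :
      (opNorm (Aᵀ * H * B) + opNorm (Bᵀ * H * B)) * (v ⬝ᵥ v) ≤ β * (v ⬝ᵥ H *ᵥ v) := by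
    rw [hβ, div_mul_eq_mul_div, le_div_iff₀ hlo0]
    have := mul_le_mul_of_nonneg_left (hlo v) (add_nonneg hP hQ)
    linarith
  obtain ⟨K, hK, s, ⟨hs0, hs1⟩, hbound⟩ :=
    exists_geometric_bound_of_delay (V := fun t => x t ⬝ᵥ H *ᵥ x t) (fun t => hV (x t))
      hα0 hβ0 hαβ (fun t => (hτ t).2) fun t ht => by
        have hsymm : Hᵀ = H := by simpa [Matrix.IsHermitian] using hH.1
        rw [hx t ht, dotProduct_mulVec_step hsymm hLyap]
        have h1 := hstepα (x t)
        have h2 := hstepβ (x (t - τ t))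
        have h3 := hcC (x t)
        have h4 := two_mul_dotProduct_mulVec_le_opNorm (Aᵀ * H * B) (x t) (x (t - τ t))
        have h5 := dotProduct_mulVec_self_le_opNorm (Bᵀ * H * B) (x (t - τ t))
        linarith
  refine ⟨√(K / ηlo), Real.sqrt_nonneg _, √s,
    ⟨Real.sqrt_pos.2 hs0, (Real.sqrt_lt' one_pos).2 (by simpa using hs1)⟩, fun t => ?_⟩
  refine le_of_sq_le_sq ?_ (by positivity)
  rw [mul_pow, pow_right_comm, Real.sq_sqrt (div_nonneg hK hlo0.le), Real.sq_sqrt hs0.le,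
    div_mul_eq_mul_div, le_div_iff₀ hlo0]
  have h1 := mul_le_mul_of_nonneg_left (norm_sq_le_dotProduct_self (x t)) hlo0.le
  linarith [hlo (x t), hbound t]
end

section
/- Discrete Halanay-type inequality: let τ̄ ≥ 1 be an integer, let α, β ≥ 0 with α + β < 1, and let v : ℕ → ℝ be a nonnegative sequence such that for every t ≥ τ̄ one has v(t+1) ≤ α·v(t) + β·max{ v(s) : t − τ̄ ≤ s ≤ t }. Then v decays exponentially: there exist K ≥ 0 and r ∈ (0,1) such that v(t) ≤ K·rᵗ for all t. -/
/-- If `α + β < 1`, then `α * r ^ n + β ≤ r ^ (n + 1)` for some `r < 1` close to `1`. -/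
theorem exists_rate_of_add_lt_one (n : ℕ) {α β : ℝ} (hαβ : α + β < 1) :
    ∃ r ∈ Set.Ioo (0 : ℝ) 1, α * r ^ n + β ≤ r ^ (n + 1) := by
  have hcont : Continuous fun r : ℝ => r ^ (n + 1) - (α * r ^ n + β) := by fun_prop
  have hpos : ∀ᶠ r in nhdsWithin (1 : ℝ) (Set.Iio 1), 0 < r ^ (n + 1) - (α * r ^ n + β) :=
    (hcont.continuousAt.eventually_const_lt (by simpa using hαβ)).filter_mono
      nhdsWithin_le_nhds
  obtain ⟨r, hr, hr01⟩ := (hpos.and (Ioo_mem_nhdsLT zero_lt_one)).exists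
  exact ⟨r, hr01, by linarith⟩

/-- A sequence that satisfies a delayed recursive inequality is dominated by any geometric
sequence that dominates its initial segment and whose ratio is compatible with the recursion. -/
theorem le_geometric_of_delayed_recursion {n : ℕ} {α β K r : ℝ} (hα : 0 ≤ α) (hβ : 0 ≤ β)
    (hK : 0 ≤ K) (hr : r ∈ Set.Ioo (0 : ℝ) 1) (hrate : α * r ^ n + β ≤ r ^ (n + 1))
    {v : ℕ → ℝ} (hinit : ∀ t ≤ n, v t ≤ K * r ^ t)
    (hrec : ∀ t, n ≤ t →
      v (t + 1) ≤ α * v t +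
        β * (Finset.Icc (t - n) t).sup' (Finset.nonempty_Icc.2 (Nat.sub_le t n)) v) (t : ℕ) :
    v t ≤ K * r ^ t := by
  induction t using Nat.strong_induction_on with
  | _ t ih =>
    rcases le_or_gt t n with htn | htn
    · exact hinit t htn
    obtain ⟨m, rfl⟩ : ∃ m, t = n + m + 1 := ⟨t - n - 1, by lia⟩
    have hsup : (Finset.Icc (n + m - n) (n + m)).sup' (Finset.nonempty_Icc.2 (Nat.sub_le _ _)) v
        ≤ K * r ^ m := by
      refine Finset.sup'_le _ _ fun s hs => ?_
      rw [Finset.mem_Icc] at hs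
      refine (ih s (by lia)).trans (mul_le_mul_of_nonneg_left ?_ hK)
      exact pow_le_pow_of_le_one hr.1.le hr.2.le (by lia)
    calc v (n + m + 1) ≤ _ := hrec (n + m) (by lia)
      _ ≤ α * (K * r ^ (n + m)) + β * (K * r ^ m) :=
        add_le_add (mul_le_mul_of_nonneg_left (ih _ (by lia)) hα)
          (mul_le_mul_of_nonneg_left hsup hβ)
      _ = K * r ^ m * (α * r ^ n + β) := by ring
      _ ≤ K * r ^ m * r ^ (n + 1) :=
        mul_le_mul_of_nonneg_left hrate (mul_nonneg hK (pow_nonneg hr.1.le m))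
      _ = K * r ^ (n + m + 1) := by ring

theorem stmt1 (τbar : ℕ) (hτbar : 1 ≤ τbar) (α β : ℝ) (hα : 0 ≤ α) (hβ : 0 ≤ β)
    (hαβ : α + β < 1) (v : ℕ → ℝ) (hv : ∀ t, 0 ≤ v t)
    (hrec : ∀ t, τbar ≤ t →
      v (t + 1) ≤ α * v t +
        β * (Finset.Icc (t - τbar) t).sup' ⟨t, by simp [Nat.sub_le]⟩ v) :
    ∃ K ≥ (0 : ℝ), ∃ r ∈ Set.Ioo (0 : ℝ) 1, ∀ t, v t ≤ K * r ^ t := by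
  obtain ⟨r, hr, hrate⟩ := exists_rate_of_add_lt_one τbar hαβ
  have hterm : ∀ s, 0 ≤ v s / r ^ s := fun s => div_nonneg (hv s) (pow_nonneg hr.1.le s)
  have hK : 0 ≤ ∑ s ∈ Finset.range (τbar + 1), v s / r ^ s :=
    Finset.sum_nonneg fun s _ => hterm s
  refine ⟨_, hK, r, hr, le_geometric_of_delayed_recursion hα hβ hK hr hrate ?_ hrec⟩
  intro t ht
  rw [← div_le_iff₀ (pow_pos hr.1 t)]
  exact Finset.single_le_sum (f := fun s => v s / r ^ s) (fun s _ => hterm s)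
    (Finset.mem_range.2 (by lia))
end

section
/- Solvability of the discrete Lyapunov equation for Schur-stable matrices: let A be a real n×n matrix all of whose complex eigenvalues have modulus strictly less than 1. Then for every symmetric positive definite real n×n matrix C₀ there exists a unique symmetric real n×n matrix H satisfying AᵀHA − H = −C₀; moreover H is positive definite and is given by the convergent series H = Σ_{k=0}^{∞} (Aᵀ)ᵏ C₀ Aᵏ. -/
open Matrix

theorem exists_eventually_norm_pow_le_of_spectralRadius_lt_one
    {B : Type*} [NormedRing B] [NormedAlgebra ℂ B] [CompleteSpace B] {a : B}
    (ha : spectralRadius ℂ a < 1) :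
    ∃ r : ℝ, 0 ≤ r ∧ r < 1 ∧ ∀ᶠ k : ℕ in Filter.atTop, ‖a ^ k‖ ≤ r ^ k := by
  obtain ⟨r, hr, hr1⟩ := ENNReal.lt_iff_exists_nnreal_btwn.1 ha
  refine ⟨r, r.2, by exact_mod_cast hr1, ?_⟩
  filter_upwards [(spectrum.pow_nnnorm_pow_one_div_tendsto_nhds_spectralRadius a).eventually_lt_const
    hr, Filter.eventually_gt_atTop 0] with k hk hk0
  have h := ENNReal.rpow_le_rpow hk.le (z := (k : ℝ)) k.cast_nonneg
  rw [← ENNReal.rpow_mul, one_div_mul_cancel (by positivity), ENNReal.rpow_one,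
    ENNReal.rpow_natCast] at h
  exact_mod_cast h

theorem spectralRadius_lt_one_of_forall_norm_lt_one
    {B : Type*} [NormedRing B] [NormedAlgebra ℂ B] [CompleteSpace B] {a : B}
    (ha : ∀ z ∈ spectrum ℂ a, ‖z‖ < 1) : spectralRadius ℂ a < 1 := by
  nontriviality B
  exact_mod_cast spectrum.spectralRadius_lt_of_forall_lt a (r := 1) fun z hz => by
    exact_mod_cast ha z hz

section Frobenius

attribute [local instance] Matrix.frobeniusNormedRing Matrix.frobeniusNormedAlgebra

theorem Matrix.summable_transpose_pow_mul_mul_pow {ι : Type*} [Fintype ι] [DecidableEq ι]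
    {A : Matrix ι ι ℝ}
    (hA : ∀ z ∈ spectrum ℂ (A.map (Complex.ofReal : ℝ → ℂ)), ‖z‖ < 1) (C : Matrix ι ι ℝ) :
    Summable fun k : ℕ => Aᵀ ^ k * C * A ^ k := by
  have : CompleteSpace (Matrix ι ι ℂ) := FiniteDimensional.complete ℂ _
  have : CompleteSpace (Matrix ι ι ℝ) := FiniteDimensional.complete ℝ _
  obtain ⟨r, hr0, hr1, hr⟩ := exists_eventually_norm_pow_le_of_spectralRadius_lt_one
    (spectralRadius_lt_one_of_forall_norm_lt_one hA)
  have hnorm (k : ℕ) : ‖(A.map (Complex.ofReal : ℝ → ℂ)) ^ k‖ = ‖A ^ k‖ := by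
    have h : (A.map (Complex.ofReal : ℝ → ℂ)) ^ k = (A ^ k).map Complex.ofReal :=
      (map_pow (Complex.ofRealHom.mapMatrix (m := ι)) A k).symm
    rw [h]
    exact Matrix.frobenius_norm_map_eq _ _ fun x => by simp
  have hgeom : Summable fun k : ℕ => ‖C‖ * (r ^ 2) ^ k :=
    (summable_geometric_of_lt_one (by positivity) (by nlinarith)).mul_left _
  refine Summable.of_norm_bounded_eventually_nat hgeom ?_
  filter_upwards [hr] with k hk
  rw [hnorm] at hk
  calc ‖Aᵀ ^ k * C * A ^ k‖ ≤ ‖Aᵀ ^ k‖ * ‖C‖ * ‖A ^ k‖ :=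
        (norm_mul_le _ _).trans (by gcongr; exact norm_mul_le _ _)
    _ = ‖A ^ k‖ * ‖C‖ * ‖A ^ k‖ := by
        rw [← Matrix.transpose_pow, Matrix.frobenius_norm_transpose]
    _ ≤ r ^ k * ‖C‖ * r ^ k := by gcongr
    _ = ‖C‖ * (r ^ 2) ^ k := by ring

end Frobenius

theorem Matrix.eq_zero_of_transpose_mul_mul_eq_self {ι : Type*} [Fintype ι] [DecidableEq ι]
    {A D : Matrix ι ι ℝ}
    (hA : ∀ z ∈ spectrum ℂ (A.map (Complex.ofReal : ℝ → ℂ)), ‖z‖ < 1)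
    (hD : Aᵀ * D * A = D) : D = 0 := by
  have hconst (k : ℕ) : Aᵀ ^ k * D * A ^ k = D := by
    induction k with
    | zero => simp
    | succ k ih =>
      calc Aᵀ ^ (k + 1) * D * A ^ (k + 1) = Aᵀ ^ k * (Aᵀ * D * A) * A ^ k := by
            rw [pow_succ, pow_succ']; simp only [Matrix.mul_assoc]
        _ = D := by rw [hD, ih]
  have h := (Matrix.summable_transpose_pow_mul_mul_pow hA D).tendsto_atTop_zero
  simp only [hconst] at h
  exact tendsto_nhds_unique tendsto_const_nhds h

theorem Matrix.PosSemidef.of_hasSum {ι κ : Type*} [Fintype ι] {f : κ → Matrix ι ι ℝ}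
    {H : Matrix ι ι ℝ} (hf : ∀ k, (f k).PosSemidef) (hH : HasSum f H) : H.PosSemidef := by
  refine Matrix.PosSemidef.of_dotProduct_mulVec_nonneg ?_ fun x => ?_
  · have h := hH.matrix_conjTranspose
    simp only [fun k => (hf k).isHermitian.eq] at h
    exact h.unique hH
  · let φ : Matrix ι ι ℝ →+ ℝ :=
      { toFun := fun M => star x ⬝ᵥ M *ᵥ x
        map_zero' := by simp
        map_add' := fun M N => by rw [Matrix.add_mulVec, dotProduct_add] }
    have hφ : Continuous φ :=
      continuous_const.dotProduct (continuous_id.matrix_mulVec continuous_const)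
    exact (hH.map φ hφ).nonneg fun k => (hf k).dotProduct_mulVec_nonneg x

theorem stmt5 {n : ℕ} (A : Matrix (Fin n) (Fin n) ℝ)
    (hA : ∀ z ∈ spectrum ℂ (A.map (Complex.ofReal : ℝ → ℂ)), ‖z‖ < 1)
    (C₀ : Matrix (Fin n) (Fin n) ℝ) (hC : C₀.PosDef) :
    ∃ H : Matrix (Fin n) (Fin n) ℝ,
      (H.IsHermitian ∧ Aᵀ * H * A - H = -C₀) ∧
      (∀ H' : Matrix (Fin n) (Fin n) ℝ,
        H'.IsHermitian ∧ Aᵀ * H' * A - H' = -C₀ → H' = H) ∧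
      H.PosDef ∧ HasSum (fun k : ℕ => (Aᵀ) ^ k * C₀ * A ^ k) H := by
  obtain ⟨H, hH⟩ := Matrix.summable_transpose_pow_mul_mul_pow hA C₀
  have hpsd : H.PosSemidef := .of_hasSum (fun k => by
    rw [← Matrix.transpose_pow]
    exact hC.posSemidef.conjTranspose_mul_mul_same (A ^ k)) hH
  have heq : H = Aᵀ * H * A + C₀ := by
    have hshift : HasSum (fun k : ℕ => Aᵀ ^ (k + 1) * C₀ * A ^ (k + 1)) (Aᵀ * H * A) := by
      have h (k : ℕ) : Aᵀ ^ (k + 1) * C₀ * A ^ (k + 1) = Aᵀ * (Aᵀ ^ k * C₀ * A ^ k) * A := by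
        rw [pow_succ', pow_succ]
        simp only [Matrix.mul_assoc]
      simpa only [h] using (hH.mul_left Aᵀ).mul_right A
    have h := (hasSum_nat_add_iff (f := fun k : ℕ => Aᵀ ^ k * C₀ * A ^ k) 1).1 hshift
    simp only [Finset.sum_range_one, pow_zero, one_mul, mul_one] at h
    exact hH.unique h
  have hlyap : Aᵀ * H * A - H = -C₀ := by
    rw [sub_eq_iff_eq_add, neg_add_eq_sub, eq_sub_iff_add_eq]
    exact heq.symm
  refine ⟨H, ⟨hpsd.isHermitian, hlyap⟩, fun H' ⟨_, hH'⟩ => ?_, ?_, hH⟩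
  · refine sub_eq_zero.1 (Matrix.eq_zero_of_transpose_mul_mul_eq_self hA ?_)
    rw [Matrix.mul_sub, Matrix.sub_mul, ← sub_eq_zero, sub_sub_sub_comm, hH', hlyap, sub_self]
  · rw [heq]
    exact Matrix.PosDef.posSemidef_add (hpsd.conjTranspose_mul_mul_same A) hC
end
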